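/- Let A be an abelian category with a stability function Z : K(A) → ℂ satisfying the two chain conditions: (a) there is no infinite sequence of subobjects ⋯ ⊂ E_{j+1} ⊂ E_j ⊂ ⋯ ⊂ E₂ ⊂ E₁ in A with φ(E_{j+1}) > φ(E_j) for all j; (b) there is no infinite sequence of quotients E₁ ↠ E₂ ↠ ⋯ ↠ E_j ↠ E_{j+1} ↠ ⋯ in A with φ(E_j) > φ(E_{j+1}) for all j. Then every nonzero object of A has a Harder–Narasimhan filtration with respect to Z. -/

import Mathlib

/-!
Bridgeland, "Stability conditions on triangulated categories", Proposition 2.4: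
existence of Harder–Narasimhan filtrations for a stability function on an abelian
category satisfying the two chain conditions.
-/

namespace Bridgeland

open CategoryTheory CategoryTheory.Limits

universe v u

variable (A : Type u) [Category.{v} A] [Abelian A]

/-- The subgroup of the free abelian group on the objects of `A` generated by the
relations `[X₂] = [X₁] + [X₃]` coming from short exact sequences `X₁ ⟶ X₂ ⟶ X₃`. -/
def sesRel : AddSubgroup (FreeAbelianGroup A) :=
  AddSubgroup.closure
    {x | ∃ S : CategoryTheory.ShortComplex A, S.ShortExact ∧
      x = FreeAbelianGroup.of S.X₂ - FreeAbelianGroup.of S.X₁ - FreeAbelianGroup.of S.X₃}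

/-- The Grothendieck group `K(A)` of an abelian category. -/
abbrev KGroupAb := FreeAbelianGroup A ⧸ sesRel A

variable {A}

/-- The class of an object of `A` in the Grothendieck group `K(A)`. -/
def toKAb (X : A) : KGroupAb A := QuotientAddGroup.mk (FreeAbelianGroup.of X)

/-- A complex number lies in the strict upper half-plane
`H = { r exp(iπφ) : r > 0, 0 < φ ≤ 1 }`. -/
def InUpperHalfPlane (z : ℂ) : Prop := 0 < z.im ∨ (z.im = 0 ∧ z.re < 0)

/-- A stability function on an abelian category `A`: a group homomorphism
`Z : K(A) → ℂ` taking every nonzero object into the strict upper half-plane `H`. -/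
def IsStabilityFunction (Z : KGroupAb A →+ ℂ) : Prop :=
  ∀ X : A, ¬ IsZero X → InUpperHalfPlane (Z (toKAb X))

/-- The phase `φ(E) = (1/π) arg Z(E) ∈ (0, 1]` of a nonzero object. -/
noncomputable def abPhase (Z : KGroupAb A →+ ℂ) (X : A) : ℝ :=
  Complex.arg (Z (toKAb X)) / Real.pi

/-- An object `E` is semistable with respect to the stability function `Z` if it is
nonzero and every nonzero subobject `X ⊆ E` satisfies `φ(X) ≤ φ(E)`. -/
def IsSemistableAb (Z : KGroupAb A →+ ℂ) (E : A) : Prop :=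
  ¬ IsZero E ∧ ∀ (X : A) (f : X ⟶ E), Mono f → ¬ IsZero X → abPhase Z X ≤ abPhase Z E

/-- On the strict upper half-plane, comparing arguments amounts to the sign of a determinant. -/
theorem arg_lt_arg_iff {z w : ℂ} (hz : InUpperHalfPlane z) (hw : InUpperHalfPlane w) :
    z.arg < w.arg ↔ 0 < z.re * w.im - z.im * w.re := by
  have arg_mem : ∀ {x : ℂ}, InUpperHalfPlane x → 0 < ‖x‖ ∧ 0 < x.arg ∧ x.arg ≤ Real.pi := by
    intro x hx
    refine ⟨?_, ?_, Complex.arg_le_pi x⟩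
    · rw [norm_pos_iff]
      rintro rfl
      simp [InUpperHalfPlane] at hx
    · have hne : x.arg ≠ 0 := by
        rw [Ne, Complex.arg_eq_zero_iff]
        rcases hx with h | h <;> rintro ⟨h1, h2⟩ <;> linarith
      have hnonneg : 0 ≤ x.arg := by
        rw [Complex.arg_nonneg_iff]
        rcases hx with h | h <;> linarith
      exact lt_of_le_of_ne hnonneg hne.symm
  obtain ⟨hz0, hz1, hz2⟩ := arg_mem hz
  obtain ⟨hw0, hw1, hw2⟩ := arg_mem hw
  have key : z.re * w.im - z.im * w.re = ‖z‖ * ‖w‖ * Real.sin (w.arg - z.arg) := by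
    rw [Real.sin_sub]
    conv_lhs => rw [← Complex.norm_mul_cos_arg z, ← Complex.norm_mul_sin_arg z,
      ← Complex.norm_mul_cos_arg w, ← Complex.norm_mul_sin_arg w]
    ring
  rw [key, mul_pos_iff_of_pos_left (mul_pos hz0 hw0)]
  constructor
  · intro h
    exact Real.sin_pos_of_pos_of_lt_pi (by linarith) (by linarith)
  · intro h
    by_contra! hle
    have := Real.sin_nonpos_of_nonpos_of_neg_pi_le (x := w.arg - z.arg) (by linarith) (by linarith)
    linarith

section

variable {A : Type u} [Category.{v} A] [Abelian A] {Z : KGroupAb A →+ ℂ}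

theorem toKAb_shortExact {S : ShortComplex A} (hS : S.ShortExact) :
    toKAb S.X₂ = toKAb S.X₁ + toKAb S.X₃ := by
  have h : FreeAbelianGroup.of S.X₂ - FreeAbelianGroup.of S.X₁ - FreeAbelianGroup.of S.X₃ ∈
      sesRel A := AddSubgroup.subset_closure ⟨S, hS, rfl⟩
  have h' := (QuotientAddGroup.eq_zero_iff _).2 h
  rw [sub_sub, QuotientAddGroup.mk_sub, QuotientAddGroup.mk_add, sub_eq_zero] at h'
  exact h'

theorem shortExact_cokernel {X Y : A} (f : X ⟶ Y) [Mono f] :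
    (ShortComplex.mk f (cokernel.π f) (cokernel.condition f)).ShortExact where
  exact := ShortComplex.exact_cokernel f

theorem shortExact_kernel {X Y : A} (f : X ⟶ Y) [Epi f] :
    (ShortComplex.mk (kernel.ι f) f (kernel.condition f)).ShortExact where
  exact := ShortComplex.exact_kernel f

theorem toKAb_eq_add_cokernel {X Y : A} (f : X ⟶ Y) [Mono f] :
    toKAb Y = toKAb X + toKAb (cokernel f) :=
  toKAb_shortExact (shortExact_cokernel f)

theorem toKAb_eq_kernel_add {X Y : A} (f : X ⟶ Y) [Epi f] :
    toKAb Y + toKAb (kernel f) = toKAb X := by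
  rw [add_comm]
  exact (toKAb_shortExact (shortExact_kernel f)).symm

theorem toKAb_of_isZero {X : A} (hX : IsZero X) : toKAb X = 0 := by
  have hc : toKAb X = toKAb X + toKAb X :=
    toKAb_shortExact (S := ShortComplex.mk (𝟙 X) (𝟙 X) (hX.eq_of_src _ _))
      { exact := ShortComplex.exact_of_isZero_X₂ _ hX }
  simpa using hc

theorem IsStabilityFunction.abPhase_lt_iff (hZ : IsStabilityFunction Z) {X Y : A}
    (hX : ¬ IsZero X) (hY : ¬ IsZero Y) :
    abPhase Z X < abPhase Z Y ↔
      0 < (Z (toKAb X)).re * (Z (toKAb Y)).im - (Z (toKAb X)).im * (Z (toKAb Y)).re := by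
  rw [abPhase, abPhase, div_lt_div_iff_of_pos_right Real.pi_pos,
    arg_lt_arg_iff (hZ X hX) (hZ Y hY)]

section Seesaw

variable {X Y W : A}

theorem IsStabilityFunction.abPhase_middle_lt_left_iff (hZ : IsStabilityFunction Z)
    (h : toKAb Y = toKAb X + toKAb W) (hX : ¬ IsZero X) (hY : ¬ IsZero Y) (hW : ¬ IsZero W) :
    abPhase Z Y < abPhase Z X ↔ abPhase Z W < abPhase Z Y := by
  rw [hZ.abPhase_lt_iff hY hX, hZ.abPhase_lt_iff hW hY, h, map_add, Complex.add_re,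
    Complex.add_im]
  ring_nf

theorem IsStabilityFunction.abPhase_right_lt_left (hZ : IsStabilityFunction Z)
    (h : toKAb Y = toKAb X + toKAb W) (hX : ¬ IsZero X) (hY : ¬ IsZero Y) (hW : ¬ IsZero W)
    (hlt : abPhase Z W < abPhase Z Y) : abPhase Z W < abPhase Z X :=
  hlt.trans ((hZ.abPhase_middle_lt_left_iff h hX hY hW).2 hlt)

end Seesaw

theorem not_isZero_of_mono {X Y : A} (f : X ⟶ Y) [Mono f] (hX : ¬ IsZero X) : ¬ IsZero Y :=
  fun h => hX (h.of_mono f)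

theorem not_isZero_of_epi {X Y : A} (f : X ⟶ Y) [Epi f] (hY : ¬ IsZero Y) : ¬ IsZero X :=
  fun h => hY (h.of_epi f)

theorem abPhase_eq_of_isZero_cokernel (Z : KGroupAb A →+ ℂ) {X Y : A} (f : X ⟶ Y) [Mono f]
    (h : IsZero (cokernel f)) : abPhase Z Y = abPhase Z X := by
  rw [abPhase, abPhase, toKAb_eq_add_cokernel f, toKAb_of_isZero h, add_zero]

theorem abPhase_eq_of_isZero_kernel (Z : KGroupAb A →+ ℂ) {X Y : A} (f : X ⟶ Y) [Epi f]
    (h : IsZero (kernel f)) : abPhase Z X = abPhase Z Y := by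
  rw [abPhase, abPhase, ← toKAb_eq_kernel_add f, toKAb_of_isZero h, add_zero]

theorem IsStabilityFunction.abPhase_cokernel_lt (hZ : IsStabilityFunction Z) {X Y : A}
    (f : X ⟶ Y) [Mono f] (hX : ¬ IsZero X) (hlt : abPhase Z Y < abPhase Z X) :
    ¬ IsZero (cokernel f) ∧ abPhase Z (cokernel f) < abPhase Z Y := by
  have hC : ¬ IsZero (cokernel f) := fun h =>
    hlt.ne (abPhase_eq_of_isZero_cokernel Z f h)
  exact ⟨hC, (hZ.abPhase_middle_lt_left_iff (toKAb_eq_add_cokernel f) hX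
    (not_isZero_of_mono f hX) hC).1 hlt⟩

theorem IsStabilityFunction.lt_abPhase_kernel (hZ : IsStabilityFunction Z) {X Y : A}
    (f : X ⟶ Y) [Epi f] (hY : ¬ IsZero Y) (hlt : abPhase Z Y < abPhase Z X) :
    ¬ IsZero (kernel f) ∧ abPhase Z X < abPhase Z (kernel f) := by
  have hK : ¬ IsZero (kernel f) := fun h =>
    hlt.ne' (abPhase_eq_of_isZero_kernel Z f h)
  exact ⟨hK, (hZ.abPhase_middle_lt_left_iff (toKAb_shortExact (shortExact_kernel f)) hK
    (not_isZero_of_epi f hY) hY).2 hlt⟩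

theorem exists_sub_of_not_isSemistableAb {E : A} (hE : ¬ IsZero E)
    (h : ¬ IsSemistableAb Z E) :
    ∃ (X : A) (f : X ⟶ E), Mono f ∧ ¬ IsZero X ∧ abPhase Z E < abPhase Z X := by
  simp only [IsSemistableAb] at h
  push Not at h
  exact h hE

theorem IsStabilityFunction.exists_quot_of_not_isSemistableAb (hZ : IsStabilityFunction Z)
    {E : A} (hE : ¬ IsZero E) (h : ¬ IsSemistableAb Z E) :
    ∃ (Q : A) (q : E ⟶ Q), Epi q ∧ ¬ IsZero Q ∧ abPhase Z Q < abPhase Z E := by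
  obtain ⟨X, f, hf, hX, hlt⟩ := exists_sub_of_not_isSemistableAb hE h
  obtain ⟨hC, hlt'⟩ := hZ.abPhase_cokernel_lt f hX hlt
  exact ⟨cokernel f, cokernel.π f, inferInstance, hC, hlt'⟩

theorem IsSemistableAb.abPhase_le_of_epi {E Q : A} (hE : IsSemistableAb Z E)
    (hZ : IsStabilityFunction Z) (q : E ⟶ Q) [Epi q] (hQ : ¬ IsZero Q) :
    abPhase Z E ≤ abPhase Z Q := by
  by_contra! hlt
  obtain ⟨hK, hlt'⟩ := hZ.lt_abPhase_kernel q hQ hlt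
  exact hlt'.not_ge (hE.2 _ (kernel.ι q) inferInstance hK)

theorem IsSemistableAb.hom_eq_zero {E F : A} (hE : IsSemistableAb Z E)
    (hF : IsSemistableAb Z F) (hZ : IsStabilityFunction Z)
    (hlt : abPhase Z F < abPhase Z E) (f : E ⟶ F) : f = 0 := by
  by_contra hf
  have hI : ¬ IsZero (Abelian.image f) := fun h => hf <| by
    rw [← Abelian.image.fac f, h.eq_of_src (Abelian.image.ι f) 0, comp_zero]
  have h1 := hE.abPhase_le_of_epi hZ (Abelian.factorThruImage f) hI
  have h2 := hF.2 _ (Abelian.image.ι f) inferInstance hI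
  linarith

/-- `X` is a nonzero subobject of `Y` of strictly larger phase. -/
def DestabilizingSub (Z : KGroupAb A →+ ℂ) (X Y : A) : Prop :=
  ∃ f : X ⟶ Y, Mono f ∧ ¬ IsZero X ∧ abPhase Z Y < abPhase Z X

/-- `X` is a nonzero quotient of `Y` of strictly smaller phase. -/
def DestabilizingQuot (Z : KGroupAb A →+ ℂ) (X Y : A) : Prop :=
  ∃ f : Y ⟶ X, Epi f ∧ ¬ IsZero X ∧ abPhase Z X < abPhase Z Y

theorem wellFounded_destabilizingSub
    (h : ¬ ∃ (E : ℕ → A) (f : ∀ j : ℕ, E (j + 1) ⟶ E j),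
      (∀ j, Mono (f j)) ∧ (∀ j, ¬ IsZero (E j)) ∧
        ∀ j, abPhase Z (E j) < abPhase Z (E (j + 1))) :
    WellFounded (DestabilizingSub Z) := by
  rw [wellFounded_iff_isEmpty_descending_chain]
  refine ⟨fun ⟨E, hE⟩ => h ?_⟩
  choose f hf using hE
  refine ⟨E, f, fun j => (hf j).1, fun j => ?_, fun j => (hf j).2.2⟩
  have := (hf j).1
  exact not_isZero_of_mono (f j) (hf j).2.1

theorem wellFounded_destabilizingQuot
    (h : ¬ ∃ (E : ℕ → A) (f : ∀ j : ℕ, E j ⟶ E (j + 1)),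
      (∀ j, Epi (f j)) ∧ (∀ j, ¬ IsZero (E j)) ∧
        ∀ j, abPhase Z (E (j + 1)) < abPhase Z (E j)) :
    WellFounded (DestabilizingQuot Z) := by
  rw [wellFounded_iff_isEmpty_descending_chain]
  refine ⟨fun ⟨E, hE⟩ => h ?_⟩
  choose f hf using hE
  refine ⟨E, f, fun j => (hf j).1, fun j => ?_, fun j => (hf j).2.2⟩
  have := (hf j).1
  exact not_isZero_of_epi (f j) (hf j).2.1

theorem exists_semistable_sub (hwf : WellFounded (DestabilizingSub Z)) (E : A)
    (hE : ¬ IsZero E) :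
    ∃ (X : A) (f : X ⟶ E), Mono f ∧ IsSemistableAb Z X ∧ abPhase Z E ≤ abPhase Z X := by
  induction E using hwf.induction with
  | _ E ih =>
    by_cases hs : IsSemistableAb Z E
    · exact ⟨E, 𝟙 E, inferInstance, hs, le_rfl⟩
    · obtain ⟨Y, f, hf, hY, hlt⟩ := exists_sub_of_not_isSemistableAb hE hs
      obtain ⟨X, g, hg, hX, hle⟩ := ih Y ⟨f, hf, hY, hlt⟩ hY
      exact ⟨X, g ≫ f, mono_comp g f, hX, hlt.le.trans hle⟩

theorem exists_semistable_quot (hZ : IsStabilityFunction Z)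
    (hwf : WellFounded (DestabilizingQuot Z)) (E : A) (hE : ¬ IsZero E) :
    ∃ (Q : A) (q : E ⟶ Q), Epi q ∧ IsSemistableAb Z Q ∧ abPhase Z Q ≤ abPhase Z E := by
  induction E using hwf.induction with
  | _ E ih =>
    by_cases hs : IsSemistableAb Z E
    · exact ⟨E, 𝟙 E, inferInstance, hs, le_rfl⟩
    · obtain ⟨Y, f, hf, hY, hlt⟩ := hZ.exists_quot_of_not_isSemistableAb hE hs
      obtain ⟨X, g, hg, hX, hle⟩ := ih Y ⟨f, hf, hY, hlt⟩ hY
      exact ⟨X, f ≫ g, epi_comp f g, hX, hle.trans hlt.le⟩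

/-- A maximally destabilising quotient: a nonzero quotient of minimal phase through which every
other nonzero quotient of that phase factors. -/
structure IsMaxDestabilizingQuot (Z : KGroupAb A →+ ℂ) {E B : A} (p : E ⟶ B) : Prop where
  epi : Epi p
  not_isZero : ¬ IsZero B
  abPhase_le : ∀ {Q : A} (q : E ⟶ Q), Epi q → ¬ IsZero Q → abPhase Z B ≤ abPhase Z Q
  factors : ∀ {Q : A} (q : E ⟶ Q), Epi q → ¬ IsZero Q → abPhase Z Q = abPhase Z B →
    ∃ g : B ⟶ Q, p ≫ g = q

theorem IsMaxDestabilizingQuot.isSemistableAb {E B : A} {p : E ⟶ B}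
    (hp : IsMaxDestabilizingQuot Z p) (hZ : IsStabilityFunction Z) : IsSemistableAb Z B := by
  by_contra hs
  obtain ⟨Q, q, hq, hQ, hlt⟩ := hZ.exists_quot_of_not_isSemistableAb hp.not_isZero hs
  have := hp.epi
  exact hlt.not_ge (hp.abPhase_le (p ≫ q) (epi_comp p q) hQ)

theorem IsSemistableAb.isMaxDestabilizingQuot_id {E : A} (hE : IsSemistableAb Z E)
    (hZ : IsStabilityFunction Z) : IsMaxDestabilizingQuot Z (𝟙 E) where
  epi := inferInstance
  not_isZero := hE.1
  abPhase_le q _ hQ := hE.abPhase_le_of_epi hZ q hQ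
  factors q _ _ _ := ⟨q, Category.id_comp q⟩

/-- A maximally destabilising quotient of `E / X` is one of `E`, if `X` is semistable of larger
phase. -/
theorem IsMaxDestabilizingQuot.comp_cokernel (hZ : IsStabilityFunction Z)
    (hquot : WellFounded (DestabilizingQuot Z)) {X E B : A} {f : X ⟶ E}
    (hX : IsSemistableAb Z X) {p : cokernel f ⟶ B} (hp : IsMaxDestabilizingQuot Z p)
    (hlt : abPhase Z B < abPhase Z X) : IsMaxDestabilizingQuot Z (cokernel.π f ≫ p) := by
  have hpe := hp.epi
  have desc : ∀ {Q : A} (q : E ⟶ Q), Epi q → IsSemistableAb Z Q → abPhase Z Q ≤ abPhase Z B →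
      ∃ q' : cokernel f ⟶ Q, Epi q' ∧ cokernel.π f ≫ q' = q := by
    intro Q q hq hQ hle
    have h0 : f ≫ q = 0 := hX.hom_eq_zero hQ hZ (hle.trans_lt hlt) _
    have hfac := cokernel.π_desc f q h0
    exact ⟨cokernel.desc f q h0, epi_of_epi_fac hfac, hfac⟩
  have le : ∀ {Q : A} (q : E ⟶ Q), Epi q → ¬ IsZero Q → abPhase Z B ≤ abPhase Z Q := by
    intro Q q hq hQ
    obtain ⟨R, r, hr, hR, hRle⟩ := exists_semistable_quot hZ hquot Q hQ
    refine le_trans ?_ hRle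
    by_contra! hcon
    obtain ⟨q', hq', -⟩ := desc (q ≫ r) (epi_comp q r) hR hcon.le
    exact hcon.not_ge (hp.abPhase_le q' hq' hR.1)
  refine ⟨epi_comp _ _, hp.not_isZero, le, fun {Q} q hq hQ heq => ?_⟩
  have hs : IsSemistableAb Z Q := by
    by_contra hs
    obtain ⟨R, r, hr, hR, hRlt⟩ := hZ.exists_quot_of_not_isSemistableAb hQ hs
    exact (hRlt.trans_eq heq).not_ge (le (q ≫ r) (epi_comp q r) hR)
  obtain ⟨q', hq', hfac⟩ := desc q hq hs heq.le
  obtain ⟨g, hg⟩ := hp.factors q' hq' hQ heq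
  exact ⟨g, by rw [Category.assoc, hg, hfac]⟩

theorem exists_isMaxDestabilizingQuot (hZ : IsStabilityFunction Z)
    (hsub : WellFounded (DestabilizingSub Z)) (hquot : WellFounded (DestabilizingQuot Z))
    (E : A) (hE : ¬ IsZero E) :
    ∃ (B : A) (p : E ⟶ B), IsMaxDestabilizingQuot Z p := by
  induction E using hquot.induction with
  | _ E ih =>
    by_cases hs : IsSemistableAb Z E
    · exact ⟨E, 𝟙 E, hs.isMaxDestabilizingQuot_id hZ⟩
    · obtain ⟨Y, f, hf, hY, hlt⟩ := exists_sub_of_not_isSemistableAb hE hs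
      obtain ⟨X, g, hg, hX, hle⟩ := exists_semistable_sub hsub Y hY
      have hlt' := hlt.trans_le hle
      obtain ⟨hC, hClt⟩ := hZ.abPhase_cokernel_lt (g ≫ f) hX.1 hlt'
      obtain ⟨B, p, hp⟩ := ih _ ⟨cokernel.π (g ≫ f), inferInstance, hC, hClt⟩ hC
      have hB := hp.abPhase_le (𝟙 _) inferInstance hC
      exact ⟨B, _, hp.comp_cokernel hZ hquot hX (by linarith)⟩

/-- The phase of the maximally destabilising quotient increases strictly on passing to its
kernel. -/
theorem IsMaxDestabilizingQuot.abPhase_lt_of_kernel (hZ : IsStabilityFunction Z) {E B B' : A}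
    {p : E ⟶ B} (hp : IsMaxDestabilizingQuot Z p) {p' : kernel p ⟶ B'}
    (hp' : IsMaxDestabilizingQuot Z p') : abPhase Z B < abPhase Z B' := by
  have := hp.epi
  have := hp'.epi
  let k : kernel p' ⟶ E := kernel.ι p' ≫ kernel.ι p
  have hadd : toKAb (cokernel k) = toKAb B' + toKAb B := by
    have h1 := toKAb_eq_add_cokernel k
    have h2 := toKAb_eq_kernel_add p
    have h3 := toKAb_eq_kernel_add p'
    rw [← h2, ← h3] at h1
    have h4 : toKAb (kernel p') + (toKAb B' + toKAb B) =
        toKAb (kernel p') + toKAb (cokernel k) := by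
      rw [← h1]; abel
    exact (add_left_cancel h4).symm
  have hker : kernel.ι p ≫ cokernel.π k ≠ 0 := by
    intro h0
    let l := Abelian.monoLift k (kernel.ι p) h0
    have hl : l ≫ k = kernel.ι p := Abelian.monoLift_comp k (kernel.ι p) h0
    have hid : l ≫ kernel.ι p' = 𝟙 _ := by
      rw [← cancel_mono (kernel.ι p), Category.assoc, Category.id_comp]
      exact hl
    have hz : p' = 0 := by
      rw [← Category.id_comp p', ← hid, Category.assoc, kernel.condition, comp_zero]
    exact hp'.not_isZero (IsZero.of_epi_eq_zero p' hz)
  have hQ : ¬ IsZero (cokernel k) := fun h => hker (h.eq_of_tgt _ _)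
  have hlt : abPhase Z B < abPhase Z (cokernel k) := by
    refine lt_of_le_of_ne (hp.abPhase_le (cokernel.π k) inferInstance hQ) fun heq => hker ?_
    obtain ⟨g, hg⟩ := hp.factors (cokernel.π k) inferInstance hQ heq.symm
    rw [← hg, kernel.condition_assoc, zero_comp]
  exact hZ.abPhase_right_lt_left hadd hp'.not_isZero hQ hp.not_isZero hlt

/-- `X ⟶ Y ⟶ F` extends to a short exact sequence for some choice of maps. -/
def IsExtension (X Y F : A) : Prop :=
  ∃ (i : X ⟶ Y) (p : Y ⟶ F) (w : i ≫ p = 0), (ShortComplex.mk i p w).ShortExact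

/-- `E` has a Harder–Narasimhan filtration all of whose factors have phase at least `c`. -/
def HasHNFiltration (Z : KGroupAb A →+ ℂ) (E : A) (c : ℝ) : Prop :=
  ∃ (n : ℕ) (_ : 0 < n) (obj : Fin (n + 1) → A) (fac : Fin n → A),
    IsZero (obj 0) ∧ obj (Fin.last n) = E ∧
    (∀ i : Fin n, IsExtension (obj i.castSucc) (obj i.succ) (fac i)) ∧
    (∀ i, IsSemistableAb Z (fac i)) ∧
    StrictAnti (fun i => abPhase Z (fac i)) ∧ ∀ i, c ≤ abPhase Z (fac i)

open ZeroObject in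
theorem IsSemistableAb.hasHNFiltration {E : A} (hE : IsSemistableAb Z E) :
    HasHNFiltration Z E (abPhase Z E) := by
  refine ⟨1, one_pos, ![0, E], fun _ => E, isZero_zero A, rfl, fun i => ?_, fun _ => hE,
    Subsingleton.strictAnti _, fun _ => le_rfl⟩
  fin_cases i
  have hses : (ShortComplex.mk (0 : (0 : A) ⟶ E) (𝟙 E) zero_comp).ShortExact :=
    { exact := (ShortComplex.exact_iff_mono _ rfl).2 (inferInstanceAs (Mono (𝟙 E)))
      mono_f := ⟨fun _ _ _ => (isZero_zero A).eq_of_tgt _ _⟩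
      epi_g := inferInstanceAs (Epi (𝟙 E)) }
  exact ⟨0, 𝟙 E, zero_comp, hses⟩

theorem HasHNFiltration.snoc {X Y F : A} {c : ℝ} (hX : HasHNFiltration Z X c)
    (hext : IsExtension X Y F) (hF : IsSemistableAb Z F) (hlt : abPhase Z F < c) :
    HasHNFiltration Z Y (abPhase Z F) := by
  obtain ⟨n, -, obj, fac, h0, hlast, hses, hss, hanti, hc⟩ := hX
  refine ⟨n + 1, n.succ_pos, Fin.snoc obj Y, Fin.snoc fac F, ?_, by simp, ?_, ?_, ?_, ?_⟩
  · rw [← Fin.castSucc_zero, Fin.snoc_castSucc]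
    exact h0
  · intro i
    induction i using Fin.lastCases with
    | last =>
      rw [Fin.succ_last, Fin.snoc_last, Fin.snoc_castSucc, Fin.snoc_last, hlast]
      exact hext
    | cast i =>
      rw [Fin.succ_castSucc, Fin.snoc_castSucc, Fin.snoc_castSucc, Fin.snoc_castSucc]
      exact hses i
  · intro i
    induction i using Fin.lastCases with
    | last => simpa using hF
    | cast i => simpa using hss i
  · intro i j hij
    induction j using Fin.lastCases with
    | last =>
      induction i using Fin.lastCases with
      | last => exact absurd hij (lt_irrefl _)
      | cast i => simpa using hlt.trans_le (hc i)
    | cast j =>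
      induction i using Fin.lastCases with
      | last => exact absurd hij (Fin.castSucc_lt_last j).not_gt
      | cast i => simpa using hanti (Fin.castSucc_lt_castSucc_iff.1 hij)
  · intro i
    induction i using Fin.lastCases with
    | last => simp
    | cast i => simpa using (hlt.trans_le (hc i)).le

theorem exists_hasHNFiltration (hZ : IsStabilityFunction Z)
    (hsub : WellFounded (DestabilizingSub Z)) (hquot : WellFounded (DestabilizingQuot Z))
    (E : A) (hE : ¬ IsZero E) :
    ∃ (B : A) (p : E ⟶ B), IsMaxDestabilizingQuot Z p ∧ HasHNFiltration Z E (abPhase Z B) := by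
  induction E using hsub.induction with
  | _ E ih =>
    by_cases hs : IsSemistableAb Z E
    · exact ⟨E, 𝟙 E, hs.isMaxDestabilizingQuot_id hZ, hs.hasHNFiltration⟩
    · obtain ⟨B, p, hp⟩ := exists_isMaxDestabilizingQuot hZ hsub hquot E hE
      have := hp.epi
      obtain ⟨Q, q, hq, hQ, hlt⟩ := hZ.exists_quot_of_not_isSemistableAb hE hs
      obtain ⟨hK, hKlt⟩ := hZ.lt_abPhase_kernel p hp.not_isZero
        ((hp.abPhase_le q hq hQ).trans_lt hlt)
      obtain ⟨B', p', hp', hHN⟩ := ih (kernel p) ⟨kernel.ι p, inferInstance, hK, hKlt⟩ hK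
      exact ⟨B, p, hp, hHN.snoc ⟨kernel.ι p, p, kernel.condition p, shortExact_kernel p⟩
        (hp.isSemistableAb hZ) (hp.abPhase_lt_of_kernel hZ hp')⟩

end

/-- **Proposition 2.4.** Let `A` be an abelian category with a stability function
`Z : K(A) → ℂ` satisfying the chain conditions: (a) there is no infinite sequence of
subobjects `⋯ ⊂ E_{j+1} ⊂ E_j ⊂ ⋯ ⊂ E₁` with `φ(E_{j+1}) > φ(E_j)` for all `j`, and
(b) there is no infinite sequence of quotients `E₁ ↠ E₂ ↠ ⋯` with `φ(E_j) > φ(E_{j+1})`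
for all `j`. Then every nonzero object of `A` has a Harder–Narasimhan filtration:
a finite chain of subobjects `0 = E₀ ⊂ E₁ ⊂ ⋯ ⊂ E_n = E` whose factors
`F_j = E_j/E_{j-1}` are semistable with strictly decreasing phases. -/
theorem harder_narasimhan_of_chain_conditions
    (Z : KGroupAb A →+ ℂ) (hZ : IsStabilityFunction Z)
    (chain_subobj : ¬ ∃ (E : ℕ → A) (f : ∀ j : ℕ, E (j + 1) ⟶ E j),
      (∀ j, Mono (f j)) ∧ (∀ j, ¬ IsZero (E j)) ∧
        ∀ j, abPhase Z (E j) < abPhase Z (E (j + 1)))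
    (chain_quot : ¬ ∃ (E : ℕ → A) (f : ∀ j : ℕ, E j ⟶ E (j + 1)),
      (∀ j, Epi (f j)) ∧ (∀ j, ¬ IsZero (E j)) ∧
        ∀ j, abPhase Z (E (j + 1)) < abPhase Z (E j)) :
    ∀ E : A, ¬ IsZero E →
      ∃ (n : ℕ) (_ : 0 < n) (obj : Fin (n + 1) → A)
        (ι : ∀ i : Fin n, obj i.castSucc ⟶ obj i.succ)
        (fac : Fin n → A) (pr : ∀ i : Fin n, obj i.succ ⟶ fac i),
        IsZero (obj 0) ∧ obj (Fin.last n) = E ∧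
        (∀ i, Mono (ι i)) ∧
        (∀ i : Fin n, ∃ w : ι i ≫ pr i = 0,
          (CategoryTheory.ShortComplex.mk (ι i) (pr i) w).ShortExact) ∧
        (∀ i, IsSemistableAb Z (fac i)) ∧
        StrictAnti (fun i => abPhase Z (fac i)) := by
  intro E hE
  obtain ⟨-, -, -, n, hn, obj, fac, h0, hlast, hses, hss, hanti, -⟩ :=
    exists_hasHNFiltration hZ (wellFounded_destabilizingSub chain_subobj)
      (wellFounded_destabilizingQuot chain_quot) E hE
  choose ι pr w hw using hses
  exact ⟨n, hn, obj, ι, fac, pr, h0, hlast, fun i => (hw i).mono_f, fun i => ⟨w i, hw i⟩,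
    hss, hanti⟩

end Bridgeland
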